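/- Let K be a field, r a positive integer, and V a finite-dimensional K-vector space which is the internal direct sum of subspaces (V_m)_{m ∈ ℤ/rℤ}. Let F : V → V be a K-linear endomorphism with F(V_m) ⊆ V_{m+1} for all m ∈ ℤ/rℤ. Then for every positive integer k not divisible by r, the trace of F^k (the k-fold composite of F) is 0. -/

import Mathlib

/-- If `F` raises the degree by `1` in a family of submodules, then `F ^ k` raises it by `k`. -/
theorem mapsTo_pow_of_map_le_add_one {R M ι : Type*} [Semiring R] [AddCommMonoid M] [Module R M]
    [AddMonoidWithOne ι] {N : ι → Submodule R M} {F : Module.End R M}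
    (hF : ∀ i, Submodule.map F (N i) ≤ N (i + 1)) (k : ℕ) (i : ι) :
    Set.MapsTo (F ^ k) (N i) (N (i + k)) := by
  induction k with
  | zero => simp [Set.MapsTo]
  | succ k ih =>
    intro x hx
    rw [pow_succ', Module.End.mul_apply, Nat.cast_succ, ← add_assoc]
    exact hF _ (Submodule.mem_map_of_mem (ih hx))

/-- If `V` is the internal direct sum of subspaces `(V_m)_{m ∈ ℤ/rℤ}` and `F` is an
endomorphism with `F(V_m) ⊆ V_{m+1}` for all `m`, then `F^k` has trace `0` for every
positive integer `k` not divisible by `r`. -/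
theorem stmt6 (K : Type*) [Field K] (V : Type*) [AddCommGroup V] [Module K V]
    [FiniteDimensional K V]
    (r : ℕ) (hr : 0 < r) (Vm : ZMod r → Submodule K V)
    (hint : DirectSum.IsInternal Vm)
    (F : Module.End K V) (hF : ∀ m : ZMod r, Submodule.map F (Vm m) ≤ Vm (m + 1))
    (k : ℕ) (hk : 0 < k) (hdvd : ¬ r ∣ k) :
    LinearMap.trace K V (F ^ k) = 0 := by
  refine LinearMap.trace_eq_zero_of_mapsTo_ne hint (· + (k : ZMod r)) (fun i hi ↦ hdvd ?_)
    (mapsTo_pow_of_map_le_add_one hF k)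
  exact (ZMod.natCast_eq_zero_iff k r).mp (add_eq_left.mp hi)
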